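/- For every p > 1 there exists C > 0 such that for all d ∈ (-1, 1): ∫_{-1}^{1} κ(d,y)² ρ(y)/(1 - y²) dy ≤ C, ∫_{-1}^{1} κ(d,y)^{p+1} ρ(y) dy ≤ C, sup_{|y|<1} κ(d,y) (1 - y²)^{1/(p-1)} ≤ C, and ‖κ(d, ·)‖_{H₀} ≤ C; that is, the family of profiles κ(d, ·) is bounded uniformly in d in all of these norms. -/

import Mathlib

open Filter Set

/-- The constant `κ₀ = (2(p+1)/(p-1)^2)^{1/(p-1)}`. -/
noncomputable def kappa0 (p : ℝ) : ℝ := (2 * (p + 1) / (p - 1) ^ 2) ^ (1 / (p - 1))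

/-- The stationary solutions `κ(d,y) = κ₀ (1-d²)^{1/(p-1)} / (1+dy)^{2/(p-1)}`. -/
noncomputable def kappa (p d y : ℝ) : ℝ :=
  kappa0 p * (1 - d ^ 2) ^ (1 / (p - 1)) / (1 + d * y) ^ (2 / (p - 1))

/-- The weight `ρ(y) = (1-y²)^{2/(p-1)}`. -/
noncomputable def rho (p y : ℝ) : ℝ := (1 - y ^ 2) ^ (2 / (p - 1))

/-- The `H₀` norm: `‖r‖_{H₀}² = ∫_{-1}^1 ((r')²(1-y²) + r²) ρ dy`. -/
noncomputable def Hnorm (p : ℝ) (r : ℝ → ℝ) : ℝ :=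
  Real.sqrt (∫ y in Set.Ioo (-1:ℝ) 1, ((deriv r y) ^ 2 * (1 - y ^ 2) + r y ^ 2) * rho p y)

lemma one_add_mul_pos {d y : ℝ} (hd : d ∈ Ioo (-1 : ℝ) 1) (hy : y ∈ Icc (-1 : ℝ) 1) :
    0 < 1 + d * y := by
  obtain ⟨h1, h2⟩ := hd
  obtain ⟨h3, h4⟩ := hy
  rcases le_total 0 d with h | h
  · nlinarith [mul_nonneg h (by linarith : 0 ≤ 1 + y)]
  · nlinarith [mul_nonneg (neg_nonneg.2 h) (by linarith : 0 ≤ 1 - y)]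

/-- The weight `(1-d²)(1-y²)/(1+dy)²`, which is `1-z²` for `z = (y+d)/(1+dy)`. -/
noncomputable def moebiusWeight (d y : ℝ) : ℝ := (1 - d ^ 2) * (1 - y ^ 2) / (1 + d * y) ^ 2

lemma one_sub_sq_pos {y : ℝ} (hy : y ∈ Ioo (-1 : ℝ) 1) : 0 < 1 - y ^ 2 := by
  obtain ⟨h1, h2⟩ := hy
  nlinarith

lemma moebiusWeight_pos {d y : ℝ} (hd : d ∈ Ioo (-1 : ℝ) 1) (hy : y ∈ Ioo (-1 : ℝ) 1) :
    0 < moebiusWeight d y :=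
  div_pos (mul_pos (one_sub_sq_pos hd) (one_sub_sq_pos hy))
    (pow_pos (one_add_mul_pos hd (Ioo_subset_Icc_self hy)) 2)

lemma moebiusWeight_le_one {d y : ℝ} (hd : d ∈ Ioo (-1 : ℝ) 1) (hy : y ∈ Ioo (-1 : ℝ) 1) :
    moebiusWeight d y ≤ 1 := by
  rw [moebiusWeight, div_le_one (pow_pos (one_add_mul_pos hd (Ioo_subset_Icc_self hy)) 2)]
  nlinarith [sq_nonneg (d + y)]

lemma kappa0_pos {p : ℝ} (hp : 1 < p) : 0 < kappa0 p := by
  have : 0 < p - 1 := by linarith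
  unfold kappa0
  positivity

lemma mul_rpow_sub_one_le {c u v : ℝ} (hc : c ≤ 1) (hu : 0 < u) (hv : 0 < v) (huv : u + v = 2) :
    (u * v) ^ (c - 1) ≤ u ^ (c - 1) + v ^ (c - 1) := by
  have hu' : 0 < u ^ (c - 1) := Real.rpow_pos_of_pos hu _
  have hv' : 0 < v ^ (c - 1) := Real.rpow_pos_of_pos hv _
  rw [Real.mul_rpow hu.le hv.le]
  rcases le_total 1 u with h | h
  · have : u ^ (c - 1) ≤ 1 := Real.rpow_le_one_of_one_le_of_nonpos h (by linarith)
    nlinarith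
  · have : v ^ (c - 1) ≤ 1 := Real.rpow_le_one_of_one_le_of_nonpos (by linarith) (by linarith)
    nlinarith

/-- The functions `w^b/(1-y²)`, with `w` the Möbius weight, have integrable majorants on `(-1,1)`
whose integrals are bounded uniformly in `d`. -/
lemma exists_majorant {b : ℝ} (hb : 0 < b) : ∃ J : ℝ, 0 < J ∧ ∀ d ∈ Ioo (-1 : ℝ) 1,
    ∃ g : ℝ → ℝ, MeasureTheory.IntegrableOn g (Ioo (-1) 1) ∧ (∫ y in Ioo (-1 : ℝ) 1, g y) ≤ J ∧
      ∀ y ∈ Ioo (-1 : ℝ) 1, moebiusWeight d y ^ b / (1 - y ^ 2) ≤ g y := by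
  set c := min b 1 with hc
  have hc0 : 0 < c := lt_min hb one_pos
  have hc1 : c ≤ 1 := min_le_right _ _
  have hcb : c ≤ b := min_le_left _ _
  refine ⟨2 * 2 ^ c / c, by positivity, fun d hd => ?_⟩
  set u : ℝ → ℝ := fun y => (1 + d) * (1 + y) / (1 + d * y) with hu
  set v : ℝ → ℝ := fun y => (1 - d) * (1 - y) / (1 + d * y) with hv
  set z' : ℝ → ℝ := fun y => (1 - d ^ 2) / (1 + d * y) ^ 2 with hz'
  set g : ℝ → ℝ := fun y => (u y ^ (c - 1) + v y ^ (c - 1)) * z' y with hg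
  have hd1 : 0 < 1 + d := by linarith [hd.1]
  have hd2 : 0 < 1 - d := by linarith [hd.2]
  have hupos : ∀ y ∈ Ioo (-1 : ℝ) 1, 0 < u y := fun y hy =>
    div_pos (mul_pos hd1 (by linarith [hy.1])) (one_add_mul_pos hd (Ioo_subset_Icc_self hy))
  have hvpos : ∀ y ∈ Ioo (-1 : ℝ) 1, 0 < v y := fun y hy =>
    div_pos (mul_pos hd2 (by linarith [hy.2])) (one_add_mul_pos hd (Ioo_subset_Icc_self hy))
  have hz'pos : ∀ y ∈ Ioo (-1 : ℝ) 1, 0 < z' y := fun y hy =>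
    div_pos (one_sub_sq_pos hd) (pow_pos (one_add_mul_pos hd (Ioo_subset_Icc_self hy)) 2)
  have hcont : ContinuousOn (fun y => (u y ^ c - v y ^ c) / c) (Icc (-1) 1) := by
    have hne : ∀ y ∈ Icc (-1 : ℝ) 1, 1 + d * y ≠ 0 := fun y hy => (one_add_mul_pos hd hy).ne'
    have hcu : ContinuousOn u (Icc (-1) 1) := ContinuousOn.div (by fun_prop) (by fun_prop) hne
    have hcv : ContinuousOn v (Icc (-1) 1) := ContinuousOn.div (by fun_prop) (by fun_prop) hne
    exact ((hcu.rpow_const fun _ _ => Or.inr hc0.le).sub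
      (hcv.rpow_const fun _ _ => Or.inr hc0.le)).div_const c
  have hderiv : ∀ y ∈ Ioo (-1 : ℝ) 1,
      HasDerivAt (fun y => (u y ^ c - v y ^ c) / c) (g y) y := by
    intro y hy
    have hD := one_add_mul_pos hd (Ioo_subset_Icc_self hy)
    have h0 : HasDerivAt (fun y : ℝ => 1 + d * y) d y := by
      simpa using ((hasDerivAt_id y).const_mul d).const_add 1
    have hu1 : HasDerivAt u (z' y) y := by
      have h1 : HasDerivAt (fun y : ℝ => (1 + d) * (1 + y)) (1 + d) y := by
        simpa using ((hasDerivAt_id y).const_add 1).const_mul (1 + d)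
      refine (h1.div h0 hD.ne').congr_deriv ?_
      simp only [hz']
      ring
    have hv1 : HasDerivAt v (-z' y) y := by
      have h1 : HasDerivAt (fun y : ℝ => (1 - d) * (1 - y)) (-(1 - d)) y := by
        simpa using ((hasDerivAt_id y).const_sub 1).const_mul (1 - d)
      refine (h1.div h0 hD.ne').congr_deriv ?_
      simp only [hz']
      ring
    refine (((hu1.rpow_const (p := c) (Or.inl (hupos y hy).ne')).sub
      (hv1.rpow_const (p := c) (Or.inl (hvpos y hy).ne'))).div_const c).congr_deriv ?_
    simp only [hg]
    field_simp
    ring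
  have hgpos : ∀ y ∈ Ioo (-1 : ℝ) 1, 0 ≤ g y := fun y hy =>
    mul_nonneg (add_nonneg (Real.rpow_nonneg (hupos y hy).le _)
      (Real.rpow_nonneg (hvpos y hy).le _)) (hz'pos y hy).le
  have hint : MeasureTheory.IntegrableOn g (Ioc (-1) 1) :=
    intervalIntegral.integrableOn_deriv_of_nonneg hcont hderiv hgpos
  refine ⟨g, hint.mono_set Ioo_subset_Ioc_self, le_of_eq ?_, fun y hy => ?_⟩
  · rw [← MeasureTheory.integral_Ioc_eq_integral_Ioo,
      ← intervalIntegral.integral_of_le (by norm_num),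
      intervalIntegral.integral_eq_sub_of_hasDerivAt_of_le (by norm_num) hcont hderiv
        ((intervalIntegrable_iff_integrableOn_Ioc_of_le (by norm_num)).2 hint)]
    have e1 : u 1 = 2 := by simp only [hu]; field_simp; ring
    have e2 : v 1 = 0 := by simp [hv]
    have e3 : u (-1) = 0 := by simp [hu]
    have e4 : v (-1) = 2 := by
      simp only [hv]
      rw [div_eq_iff (by linarith)]
      ring
    simp only [e1, e2, e3, e4, Real.zero_rpow hc0.ne']
    ring
  · have hD := one_add_mul_pos hd (Ioo_subset_Icc_self hy)
    have hy' := one_sub_sq_pos hy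
    have hw := moebiusWeight_pos hd hy
    have huv : moebiusWeight d y = u y * v y := by
      simp only [hu, hv, moebiusWeight]; field_simp; ring
    have hsum : u y + v y = 2 := by simp only [hu, hv]; field_simp; ring
    have hwz : moebiusWeight d y / (1 - y ^ 2) = z' y := by
      simp only [hz', moebiusWeight]; field_simp
    calc moebiusWeight d y ^ b / (1 - y ^ 2)
        ≤ moebiusWeight d y ^ c / (1 - y ^ 2) := by
          gcongr ?_ / _
          exact Real.rpow_le_rpow_of_exponent_ge hw (moebiusWeight_le_one hd hy) hcb
      _ = (u y * v y) ^ (c - 1) * z' y := by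
          rw [← hwz, ← huv, Real.rpow_sub_one hw.ne']
          field_simp
      _ ≤ g y := mul_le_mul_of_nonneg_right
          (mul_rpow_sub_one_le hc1 (hupos y hy) (hvpos y hy) hsum) (hz'pos y hy).le

lemma kappa_mul_rpow {p d y : ℝ} (hd : d ∈ Ioo (-1 : ℝ) 1) (hy : y ∈ Ioo (-1 : ℝ) 1) :
    kappa p d y * (1 - y ^ 2) ^ (1 / (p - 1)) =
      kappa0 p * moebiusWeight d y ^ (1 / (p - 1)) := by
  have hD := one_add_mul_pos hd (Ioo_subset_Icc_self hy)
  have h1 := one_sub_sq_pos hd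
  have h2 := one_sub_sq_pos hy
  have e : ((1 + d * y) ^ 2) ^ (1 / (p - 1)) = (1 + d * y) ^ (2 / (p - 1)) := by
    rw [← Real.rpow_natCast, ← Real.rpow_mul hD.le]
    congr 1
    push_cast
    ring
  rw [moebiusWeight, Real.div_rpow (by positivity) (by positivity), Real.mul_rpow h1.le h2.le, e,
    kappa]
  ring

lemma sq_rpow_one_div {p x : ℝ} (hx : 0 ≤ x) :
    (x ^ (1 / (p - 1))) ^ 2 = x ^ (2 / (p - 1)) := by
  rw [← Real.rpow_mul_natCast hx]
  congr 1
  push_cast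
  ring

lemma kappa_sq_mul_rho {p d y : ℝ} (hd : d ∈ Ioo (-1 : ℝ) 1) (hy : y ∈ Ioo (-1 : ℝ) 1) :
    kappa p d y ^ 2 * rho p y = kappa0 p ^ 2 * moebiusWeight d y ^ (2 / (p - 1)) := by
  rw [rho, ← sq_rpow_one_div (one_sub_sq_pos hy).le, ← mul_pow, kappa_mul_rpow hd hy, mul_pow,
    sq_rpow_one_div (moebiusWeight_pos hd hy).le]

lemma kappa_pos {p d y : ℝ} (hp : 1 < p) (hd : d ∈ Ioo (-1 : ℝ) 1) (hy : y ∈ Ioo (-1 : ℝ) 1) :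
    0 < kappa p d y :=
  div_pos (mul_pos (kappa0_pos hp) (Real.rpow_pos_of_pos (one_sub_sq_pos hd) _))
    (Real.rpow_pos_of_pos (one_add_mul_pos hd (Ioo_subset_Icc_self hy)) _)

lemma rho_pos {p y : ℝ} (hy : y ∈ Ioo (-1 : ℝ) 1) : 0 < rho p y :=
  Real.rpow_pos_of_pos (one_sub_sq_pos hy) _

lemma kappa_rpow_mul_rho {p d y : ℝ} (hp : 1 < p) (hd : d ∈ Ioo (-1 : ℝ) 1)
    (hy : y ∈ Ioo (-1 : ℝ) 1) :
    kappa p d y ^ (p + 1) * rho p y =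
      kappa0 p ^ (p + 1) * (moebiusWeight d y ^ (2 / (p - 1)) * moebiusWeight d y / (1 - y ^ 2)) := by
  have hy' := one_sub_sq_pos hy
  have hw := moebiusWeight_pos hd hy
  have hp1 : p - 1 ≠ 0 := by linarith
  have key : ∀ x : ℝ, 0 < x → (x ^ (1 / (p - 1))) ^ (p + 1) = x ^ (2 / (p - 1)) * x := by
    intro x hx
    rw [← Real.rpow_mul hx.le, ← Real.rpow_add_one hx.ne']
    congr 1
    field_simp
    ring
  have h := congrArg (fun t : ℝ => t ^ (p + 1)) (kappa_mul_rpow (p := p) hd hy)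
  rw [Real.mul_rpow (kappa_pos hp hd hy).le (by positivity),
    Real.mul_rpow (kappa0_pos hp).le (by positivity), key _ hy', key _ hw] at h
  rw [← mul_div_assoc, ← h, rho]
  field_simp

lemma deriv_kappa {p d y : ℝ} (hd : d ∈ Ioo (-1 : ℝ) 1) (hy : y ∈ Ioo (-1 : ℝ) 1) :
    deriv (fun y => kappa p d y) y = -(2 / (p - 1)) * (d / (1 + d * y)) * kappa p d y := by
  have hD := one_add_mul_pos hd (Ioo_subset_Icc_self hy)
  have h0 : HasDerivAt (fun y : ℝ => 1 + d * y) d y := by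
    simpa using ((hasDerivAt_id y).const_mul d).const_add 1
  have hr := h0.rpow_const (p := 2 / (p - 1)) (Or.inl hD.ne')
  have hpos : (0 : ℝ) < (1 + d * y) ^ (2 / (p - 1)) := Real.rpow_pos_of_pos hD _
  have := ((hasDerivAt_const y (kappa0 p * (1 - d ^ 2) ^ (1 / (p - 1)))).div hr hpos.ne').deriv
  refine Eq.trans this ?_
  rw [kappa, Real.rpow_sub_one hD.ne']
  field_simp
  ring

lemma energy_density_le {p d y : ℝ} (hd : d ∈ Ioo (-1 : ℝ) 1)
    (hy : y ∈ Ioo (-1 : ℝ) 1) :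
    (deriv (fun y => kappa p d y) y ^ 2 * (1 - y ^ 2) + kappa p d y ^ 2) * rho p y ≤
      (4 * (2 / (p - 1)) ^ 2 + 1) * kappa0 p ^ 2 *
        (moebiusWeight d y ^ (2 / (p - 1)) / (1 - y ^ 2)) := by
  have hD := one_add_mul_pos hd (Ioo_subset_Icc_self hy)
  have hy' := one_sub_sq_pos hy
  have hw : 0 < moebiusWeight d y ^ (2 / (p - 1)) :=
    Real.rpow_pos_of_pos (moebiusWeight_pos hd hy) _
  set b := 2 / (p - 1) with hb
  have hquot : (d / (1 + d * y)) ^ 2 * (1 - y ^ 2) ^ 2 ≤ 4 := by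
    have h1 : 1 - y ^ 2 ≤ 2 * (1 + d * y) := by
      obtain ⟨h1, h2⟩ := hd
      obtain ⟨h3, h4⟩ := hy
      rcases le_total 0 y with h | h
      · nlinarith
      · nlinarith
    have hd2 : d ^ 2 ≤ 1 := by linarith [one_sub_sq_pos hd]
    have h2 : (1 - y ^ 2) ^ 2 ≤ (2 * (1 + d * y)) ^ 2 := by gcongr
    rw [div_pow, div_mul_eq_mul_div, div_le_iff₀ (by positivity)]
    nlinarith [sq_nonneg (1 - y ^ 2)]
  have hfac : b ^ 2 * ((d / (1 + d * y)) ^ 2 * (1 - y ^ 2) ^ 2) + (1 - y ^ 2) ≤ 4 * b ^ 2 + 1 := by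
    nlinarith [sq_nonneg b, sq_nonneg y, mul_le_mul_of_nonneg_left hquot (sq_nonneg b)]
  rw [deriv_kappa hd hy]
  calc ((-b * (d / (1 + d * y)) * kappa p d y) ^ 2 * (1 - y ^ 2) + kappa p d y ^ 2) * rho p y
      = (b ^ 2 * (d / (1 + d * y)) ^ 2 * (1 - y ^ 2) + 1) * (kappa p d y ^ 2 * rho p y) := by ring
    _ = (b ^ 2 * ((d / (1 + d * y)) ^ 2 * (1 - y ^ 2) ^ 2) + (1 - y ^ 2)) *
          (kappa0 p ^ 2 * (moebiusWeight d y ^ b / (1 - y ^ 2))) := by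
        rw [kappa_sq_mul_rho hd hy, ← hb]
        field_simp
    _ ≤ (4 * b ^ 2 + 1) * (kappa0 p ^ 2 * (moebiusWeight d y ^ b / (1 - y ^ 2))) := by gcongr
    _ = _ := by ring

lemma setIntegral_le_const_mul {s : Set ℝ} (hs : MeasurableSet s) {f h g : ℝ → ℝ} {J K : ℝ}
    (hg : MeasureTheory.IntegrableOn g s) (hgJ : (∫ y in s, g y) ≤ J) (hK : 0 ≤ K)
    (hhg : ∀ y ∈ s, h y ≤ g y) (hf0 : ∀ y ∈ s, 0 ≤ f y) (hf : ∀ y ∈ s, f y ≤ K * h y) :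
    (∫ y in s, f y) ≤ K * J := by
  refine le_trans (MeasureTheory.integral_mono_of_nonneg
    (MeasureTheory.ae_restrict_of_forall_mem hs hf0) (hg.const_mul K)
    (MeasureTheory.ae_restrict_of_forall_mem hs fun y hy =>
      (hf y hy).trans (mul_le_mul_of_nonneg_left (hhg y hy) hK))) ?_
  rw [MeasureTheory.integral_const_mul]
  gcongr

/-- the profiles `κ(d,·)` are bounded uniformly in `d` in the norms
`L²_{ρ/(1-y²)}`, `L^{p+1}_ρ`, weighted `L^∞` and `H₀`. -/
theorem stmt_18 (p : ℝ) (hp : 1 < p) :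
    ∃ C : ℝ, 0 < C ∧ ∀ d ∈ Set.Ioo (-1:ℝ) 1,
      (∫ y in Set.Ioo (-1:ℝ) 1, kappa p d y ^ 2 * rho p y / (1 - y ^ 2)) ≤ C ∧
      (∫ y in Set.Ioo (-1:ℝ) 1, kappa p d y ^ (p + 1) * rho p y) ≤ C ∧
      (∀ y ∈ Set.Ioo (-1:ℝ) 1, kappa p d y * (1 - y ^ 2) ^ (1 / (p - 1)) ≤ C) ∧
      Hnorm p (fun y => kappa p d y) ≤ C := by
  have hk := kappa0_pos hp
  obtain ⟨J, hJ, H⟩ := exists_majorant (div_pos two_pos (sub_pos.2 hp))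
  set A := (4 * (2 / (p - 1)) ^ 2 + 1) * kappa0 p ^ 2
  have h1 : 0 ≤ kappa0 p ^ 2 * J := by positivity
  have h2 : 0 ≤ kappa0 p ^ (p + 1) * J := by positivity
  have h4 : 0 ≤ √(A * J) := Real.sqrt_nonneg _
  refine ⟨kappa0 p ^ 2 * J + kappa0 p ^ (p + 1) * J + kappa0 p + √(A * J), by positivity,
    fun d hd => ?_⟩
  obtain ⟨g, hg, hgJ, hle⟩ := H d hd
  refine ⟨?_, ?_, fun y hy => ?_, ?_⟩
  · refine le_trans (setIntegral_le_const_mul measurableSet_Ioo hg hgJ (K := kappa0 p ^ 2)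
      (by positivity) hle (fun y hy => ?_) fun y hy => ?_) (by linarith)
    · exact div_nonneg (mul_nonneg (sq_nonneg _) (rho_pos hy).le) (one_sub_sq_pos hy).le
    · rw [kappa_sq_mul_rho hd hy, mul_div_assoc]
  · refine le_trans (setIntegral_le_const_mul measurableSet_Ioo hg hgJ (K := kappa0 p ^ (p + 1))
      (by positivity) hle (fun y hy => ?_) fun y hy => ?_) (by linarith)
    · exact mul_nonneg (Real.rpow_nonneg (kappa_pos hp hd hy).le _) (rho_pos hy).le
    · rw [kappa_rpow_mul_rho hp hd hy]
      have hy' := one_sub_sq_pos hy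
      gcongr
      exact mul_le_of_le_one_right (Real.rpow_nonneg (moebiusWeight_pos hd hy).le _)
        (moebiusWeight_le_one hd hy)
  · have hw : moebiusWeight d y ^ (1 / (p - 1)) ≤ 1 :=
      Real.rpow_le_one (moebiusWeight_pos hd hy).le (moebiusWeight_le_one hd hy)
        (one_div_nonneg.2 (by linarith))
    rw [kappa_mul_rpow hd hy]
    linarith [mul_le_of_le_one_right hk.le hw]
  · refine le_trans (Real.sqrt_le_sqrt (setIntegral_le_const_mul measurableSet_Ioo hg hgJ (K := A)
      (by positivity) hle (fun y hy => ?_) fun y hy => energy_density_le hd hy)) (by linarith)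
    exact mul_nonneg (add_nonneg (mul_nonneg (sq_nonneg _) (one_sub_sq_pos hy).le) (sq_nonneg _))
      (rho_pos hy).le
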